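/- For λ+μ < δ, the energy functional J_{λ,μ} is coercive and bounded below on the Nehari manifold N_{λ,μ}: there is a constant M ∈ ℝ with J_{λ,μ}(u,v) ≥ M for all (u,v) ∈ N_{λ,μ}, and J_{λ,μ}(u,v) → +∞ as ‖(u,v)‖ → ∞ along N_{λ,μ}; in fact for ‖(u,v)‖ > 1 one has J_{λ,μ}(u,v) ≥ (1/p⁺ − 1/(α⁻+β⁻))‖(u,v)‖^{p⁻} − C₁(λ+μ)(1/q⁻ − 1/(α⁻+β⁻))‖(u,v)‖^{q⁺}. -/

import Mathlib

open MeasureTheory Real Set Filter Topology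

noncomputable section

abbrev Euc (N : ℕ) := EuclideanSpace ℝ (Fin N)

/-- `Φ⁻ := inf_D Φ`. -/
def infOn {X : Type*} (g : X → ℝ) (D : Set X) : ℝ := sInf (g '' D)

/-- `Φ⁺ := sup_D Φ`. -/
def supOn {X : Type*} (g : X → ℝ) (D : Set X) : ℝ := sSup (g '' D)

/-- `C₊(D)`: continuous on `D` with `1 < g⁻ ≤ g⁺ < ∞`. -/
def CPlus {X : Type*} [TopologicalSpace X] (D : Set X) (g : X → ℝ) : Prop :=
  ContinuousOn g D ∧ 1 < infOn g D ∧ BddAbove (g '' D)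

variable {N : ℕ}

/-- the modular `ρ_γ(u) = ∫_Ω |u|^{γ(x)} dx`. -/
def modular (Ω : Set (Euc N)) (γ u : Euc N → ℝ) : ℝ := ∫ x in Ω, |u x| ^ γ x

/-- membership in the variable exponent Lebesgue space `L^{γ(x)}(Ω)`. -/
def MemVarLp (Ω : Set (Euc N)) (γ u : Euc N → ℝ) : Prop :=
  AEMeasurable u (volume.restrict Ω) ∧ IntegrableOn (fun x => |u x| ^ γ x) Ω

/-- the Luxemburg norm on `L^{γ(x)}(Ω)`. -/
def luxNorm (Ω : Set (Euc N)) (γ u : Euc N → ℝ) : ℝ :=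
  sInf {η : ℝ | 0 < η ∧ (∫ x in Ω, (|u x| / η) ^ γ x) ≤ 1}

/-- the scaled Gagliardo modular over a set `D ⊆ ℝ^N × ℝ^N`. -/
def gagliardoOn (D : Set (Euc N × Euc N)) (s : ℝ) (p : Euc N × Euc N → ℝ)
    (u : Euc N → ℝ) (η : ℝ) : ℝ :=
  ∫ z in D, |u z.1 - u z.2| ^ p z / (η ^ p z * ‖z.1 - z.2‖ ^ ((N : ℝ) + s * p z))

/-- the seminorm `[u]_Ω^{s,p(x,y)}` of `W`. -/
def Wseminorm (Ω : Set (Euc N)) (s : ℝ) (p : Euc N × Euc N → ℝ) (u : Euc N → ℝ) : ℝ :=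
  sInf {η : ℝ | 0 < η ∧ gagliardoOn (Ω ×ˢ Ω) s p u η < 1}

/-- the norm of `W = W^{s,p̄(x),p(x,y)}(Ω)`. -/
def WNorm (Ω : Set (Euc N)) (s : ℝ) (p : Euc N × Euc N → ℝ) (u : Euc N → ℝ) : ℝ :=
  luxNorm Ω (fun x => p (x, x)) u + Wseminorm Ω s p u

/-- membership in `W = W^{s,p̄(x),p(x,y)}(Ω)`. -/
def MemW (Ω : Set (Euc N)) (s : ℝ) (p : Euc N × Euc N → ℝ) (u : Euc N → ℝ) : Prop :=
  Measurable u ∧ IntegrableOn (fun x => |u x| ^ p (x, x)) Ω ∧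
    ∃ η > (0 : ℝ), IntegrableOn
      (fun z : Euc N × Euc N =>
        |u z.1 - u z.2| ^ p z / (η ^ p z * ‖z.1 - z.2‖ ^ ((N : ℝ) + s * p z))) (Ω ×ˢ Ω)

/-- the modular `ρ_{X₀}`. -/
def rhoX0 (s : ℝ) (p : Euc N × Euc N → ℝ) (u : Euc N → ℝ) : ℝ :=
  ∫ z : Euc N × Euc N, |u z.1 - u z.2| ^ p z / ‖z.1 - z.2‖ ^ ((N : ℝ) + s * p z)

/-- the Luxemburg-type norm of `X₀`. -/
def X0Norm (s : ℝ) (p : Euc N × Euc N → ℝ) (u : Euc N → ℝ) : ℝ :=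
  sInf {η : ℝ | 0 < η ∧ gagliardoOn univ s p u η ≤ 1}

/-- membership in `X₀`: vanishing a.e. outside `Ω` and finite scaled Gagliardo modular. -/
def MemX0 (Ω : Set (Euc N)) (s : ℝ) (p : Euc N × Euc N → ℝ) (u : Euc N → ℝ) : Prop :=
  Measurable u ∧ (∀ᵐ x ∂(volume : Measure (Euc N)), x ∉ Ω → u x = 0) ∧
    ∃ η > (0 : ℝ), Integrable
      (fun z : Euc N × Euc N =>
        |u z.1 - u z.2| ^ p z / (η ^ p z * ‖z.1 - z.2‖ ^ ((N : ℝ) + s * p z)))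

/-- the norm `‖(u,v)‖ = max {‖u‖_{X₀}, ‖v‖_{X₀}}` on `E = X₀ × X₀`. -/
def pairNorm (s : ℝ) (p : Euc N × Euc N → ℝ) (u v : Euc N → ℝ) : ℝ :=
  max (X0Norm s p u) (X0Norm s p v)

/-- the critical exponent `p*_s(x) = N p̄(x)/(N − s p̄(x))`. -/
def pstar (N : ℕ) (s : ℝ) (p : Euc N × Euc N → ℝ) (x : Euc N) : ℝ :=
  (N : ℝ) * p (x, x) / ((N : ℝ) - s * p (x, x))

/-- `P(u,v)`. -/
def Pfun (s : ℝ) (p : Euc N × Euc N → ℝ) (u v : Euc N → ℝ) : ℝ :=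
  ∫ z : Euc N × Euc N,
    (|u z.1 - u z.2| ^ p z + |v z.1 - v z.2| ^ p z) / ‖z.1 - z.2‖ ^ ((N : ℝ) + s * p z)

/-- `Q(u,v)`. -/
def Qfun (Ω : Set (Euc N)) (q a b : Euc N → ℝ) (lam mu : ℝ) (u v : Euc N → ℝ) : ℝ :=
  ∫ x in Ω, (lam * a x * |u x| ^ q x + mu * b x * |v x| ^ q x)

/-- `R(u,v)`. -/
def Rfun (Ω : Set (Euc N)) (α β c : Euc N → ℝ) (u v : Euc N → ℝ) : ℝ :=
  ∫ x in Ω, c x * |u x| ^ α x * |v x| ^ β x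

/-- the energy functional `J_{λ,μ}`. -/
def Jfun (Ω : Set (Euc N)) (s : ℝ) (p : Euc N × Euc N → ℝ) (q α β a b c : Euc N → ℝ)
    (lam mu : ℝ) (u v : Euc N → ℝ) : ℝ :=
  (∫ z : Euc N × Euc N,
      (|u z.1 - u z.2| ^ p z + |v z.1 - v z.2| ^ p z) /
        (p z * ‖z.1 - z.2‖ ^ ((N : ℝ) + s * p z)))
  - (∫ x in Ω, (lam * a x * |u x| ^ q x + mu * b x * |v x| ^ q x) / q x)
  - ∫ x in Ω, c x * |u x| ^ α x * |v x| ^ β x / (α x + β x)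

/-- `φ''_{u,v}(1)`, the second derivative at `t = 1` of the fibering map. -/
def phiSecond (Ω : Set (Euc N)) (s : ℝ) (p : Euc N × Euc N → ℝ) (q α β a b c : Euc N → ℝ)
    (lam mu : ℝ) (u v : Euc N → ℝ) : ℝ :=
  (∫ z : Euc N × Euc N,
      (p z - 1) * (|u z.1 - u z.2| ^ p z + |v z.1 - v z.2| ^ p z) /
        ‖z.1 - z.2‖ ^ ((N : ℝ) + s * p z))
  - (∫ x in Ω, (q x - 1) * (lam * a x * |u x| ^ q x + mu * b x * |v x| ^ q x))
  - ∫ x in Ω, (α x + β x - 1) * (c x * |u x| ^ α x * |v x| ^ β x)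

/-- `(u,v) ≠ (0,0)` in `E`. -/
def Nontriv (u v : Euc N → ℝ) : Prop :=
  ¬ (u =ᵐ[(volume : Measure (Euc N))] 0 ∧ v =ᵐ[(volume : Measure (Euc N))] 0)

/-- membership in the Nehari manifold `N_{λ,μ}`:
`⟨J'(u,v),(u,v)⟩ = P(u,v) − Q(u,v) − R(u,v) = 0`. -/
def InNehari (Ω : Set (Euc N)) (s : ℝ) (p : Euc N × Euc N → ℝ) (q α β a b c : Euc N → ℝ)
    (lam mu : ℝ) (u v : Euc N → ℝ) : Prop :=
  MemX0 Ω s p u ∧ MemX0 Ω s p v ∧ Nontriv u v ∧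
    Pfun s p u v - Qfun Ω q a b lam mu u v - Rfun Ω α β c u v = 0

/-- `N⁺_{λ,μ}`. -/
def InNPlus (Ω : Set (Euc N)) (s : ℝ) (p : Euc N × Euc N → ℝ) (q α β a b c : Euc N → ℝ)
    (lam mu : ℝ) (u v : Euc N → ℝ) : Prop :=
  InNehari Ω s p q α β a b c lam mu u v ∧ 0 < phiSecond Ω s p q α β a b c lam mu u v

/-- `N⁻_{λ,μ}`. -/
def InNMinus (Ω : Set (Euc N)) (s : ℝ) (p : Euc N × Euc N → ℝ) (q α β a b c : Euc N → ℝ)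
    (lam mu : ℝ) (u v : Euc N → ℝ) : Prop :=
  InNehari Ω s p q α β a b c lam mu u v ∧ phiSecond Ω s p q α β a b c lam mu u v < 0

/-- `N⁰_{λ,μ}`. -/
def InNZero (Ω : Set (Euc N)) (s : ℝ) (p : Euc N × Euc N → ℝ) (q α β a b c : Euc N → ℝ)
    (lam mu : ℝ) (u v : Euc N → ℝ) : Prop :=
  InNehari Ω s p q α β a b c lam mu u v ∧ phiSecond Ω s p q α β a b c lam mu u v = 0

/-- `(u,v)` is a weak solution of the system, i.e. `J'_{λ,μ}(u,v) = 0` in the dual of `E`. -/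
def IsWeakSolution (Ω : Set (Euc N)) (s : ℝ) (p : Euc N × Euc N → ℝ)
    (q α β a b c : Euc N → ℝ) (lam mu : ℝ) (u v : Euc N → ℝ) : Prop :=
  ∀ φ ψ : Euc N → ℝ, MemX0 Ω s p φ → MemX0 Ω s p ψ →
    ((∫ z : Euc N × Euc N,
        |u z.1 - u z.2| ^ (p z - 2) * (u z.1 - u z.2) * (φ z.1 - φ z.2) /
          ‖z.1 - z.2‖ ^ ((N : ℝ) + s * p z))
      + ∫ z : Euc N × Euc N,
          |v z.1 - v z.2| ^ (p z - 2) * (v z.1 - v z.2) * (ψ z.1 - ψ z.2) /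
            ‖z.1 - z.2‖ ^ ((N : ℝ) + s * p z))
    = (∫ x in Ω, (lam * a x * |u x| ^ (q x - 2) * u x * φ x
        + mu * b x * |v x| ^ (q x - 2) * v x * ψ x))
      + (∫ x in Ω, α x / (α x + β x) * c x * |u x| ^ (α x - 2) * u x * |v x| ^ β x * φ x)
      + ∫ x in Ω, β x / (α x + β x) * c x * |v x| ^ (α x - 2) * v x * |u x| ^ β x * ψ x

/-- the standing hypotheses: `Ω` a bounded domain, `s ∈ (0,1)`, (P1)–(P2) with `s p⁺ < N`,
and (A1)–(A4). -/
def HypAll (N : ℕ) (Ω : Set (Euc N)) (s : ℝ) (p : Euc N × Euc N → ℝ)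
    (q α β a b c : Euc N → ℝ) : Prop :=
  2 ≤ N ∧ IsOpen Ω ∧ Bornology.IsBounded Ω ∧ Ω.Nonempty ∧
  0 < s ∧ s < 1 ∧
  CPlus univ p ∧ (∀ x y : Euc N, p (x, y) = p (y, x)) ∧ s * supOn p univ < (N : ℝ) ∧
  CPlus (closure Ω) q ∧ CPlus (closure Ω) α ∧ CPlus (closure Ω) β ∧
  supOn q (closure Ω) < infOn p univ ∧
  supOn p univ < infOn α (closure Ω) + infOn β (closure Ω) ∧
  supOn α (closure Ω) + supOn β (closure Ω) < infOn (pstar N s p) (closure Ω) ∧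
  infOn p univ / (supOn α (closure Ω) + supOn β (closure Ω)) <
    (infOn p univ - supOn q (closure Ω)) /
        (supOn α (closure Ω) + supOn β (closure Ω) - supOn q (closure Ω)) *
      ((infOn α (closure Ω) + infOn β (closure Ω) - infOn q (closure Ω)) /
        (supOn p univ - infOn q (closure Ω))) ∧
  Measurable a ∧ Measurable b ∧ Measurable c ∧
  (∀ x, 0 ≤ a x) ∧ (∀ x, 0 ≤ b x) ∧ (∀ x, 0 ≤ c x) ∧
  MemVarLp Ω (fun x => (α x + β x) / (α x + β x - q x)) a ∧
  MemVarLp Ω (fun x => (α x + β x) / (α x + β x - q x)) b ∧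
  (∃ M : ℝ, ∀ x, c x ≤ M)

/-- the estimate `Q(u,v) ≤ C₁(λ+μ)·max{‖(u,v)‖^{q⁻},‖(u,v)‖^{q⁺}}`. -/
def QEstimate (Ω : Set (Euc N)) (s : ℝ) (p : Euc N × Euc N → ℝ) (q a b : Euc N → ℝ)
    (C₁ : ℝ) : Prop :=
  ∀ lam mu : ℝ, 0 < lam → 0 < mu → ∀ u v : Euc N → ℝ,
    MemX0 Ω s p u → MemX0 Ω s p v →
      Qfun Ω q a b lam mu u v ≤ C₁ * (lam + mu) *
        max (pairNorm s p u v ^ infOn q (closure Ω))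
          (pairNorm s p u v ^ supOn q (closure Ω))

/-- the estimate `R(u,v) ≤ C₂·max{‖(u,v)‖^{α⁻+β⁻},‖(u,v)‖^{α⁺+β⁺}}`. -/
def REstimate (Ω : Set (Euc N)) (s : ℝ) (p : Euc N × Euc N → ℝ) (α β c : Euc N → ℝ)
    (C₂ : ℝ) : Prop :=
  ∀ u v : Euc N → ℝ, MemX0 Ω s p u → MemX0 Ω s p v →
    Rfun Ω α β c u v ≤ C₂ *
      max (pairNorm s p u v ^ (infOn α (closure Ω) + infOn β (closure Ω)))
        (pairNorm s p u v ^ (supOn α (closure Ω) + supOn β (closure Ω)))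

/-- the threshold
`δ = (1/C₁)·[(α⁻+β⁻−p⁺)/(α⁻+β⁻−q⁻)]·[(p⁻−q⁺)/(C₂(α⁺+β⁺−q⁺))]^{(p⁺−q⁻)/(α⁻+β⁻−p⁺)}`. -/
def deltaConst (Ω : Set (Euc N)) (p : Euc N × Euc N → ℝ) (q α β : Euc N → ℝ)
    (C₁ C₂ : ℝ) : ℝ :=
  (1 / C₁) *
    ((infOn α (closure Ω) + infOn β (closure Ω) - supOn p univ) /
      (infOn α (closure Ω) + infOn β (closure Ω) - infOn q (closure Ω))) *
    ((infOn p univ - supOn q (closure Ω)) /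
        (C₂ * (supOn α (closure Ω) + supOn β (closure Ω) - supOn q (closure Ω)))) ^
      ((supOn p univ - infOn q (closure Ω)) /
        (infOn α (closure Ω) + infOn β (closure Ω) - supOn p univ))

/-- scaling `t·u`. -/
def scale (t : ℝ) (u : Euc N → ℝ) : Euc N → ℝ := fun x => t * u x

/-- weak convergence `u_m ⇀ u` in `X₀`, tested through the isometric embedding
`u ↦ (u(x)−u(y))` of `X₀` into `L^{p(x,y)}(dx dy/|x−y|^{N+sp(x,y)})`. -/
def WeakTendstoX0 (s : ℝ) (p : Euc N × Euc N → ℝ) (um : ℕ → Euc N → ℝ)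
    (u : Euc N → ℝ) : Prop :=
  ∀ g : Euc N × Euc N → ℝ, Measurable g →
    Integrable (fun z : Euc N × Euc N =>
      |g z| ^ (p z / (p z - 1)) / ‖z.1 - z.2‖ ^ ((N : ℝ) + s * p z)) →
    Tendsto (fun m => ∫ z : Euc N × Euc N,
        (um m z.1 - um m z.2) * g z / ‖z.1 - z.2‖ ^ ((N : ℝ) + s * p z)) atTop
      (𝓝 (∫ z : Euc N × Euc N, (u z.1 - u z.2) * g z / ‖z.1 - z.2‖ ^ ((N : ℝ) + s * p z)))
/-- A positive infimum forces boundedness below, since `sInf` of an unbounded set of reals is `0`. -/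
theorem infOn_le {X : Type*} {g : X → ℝ} {D : Set X} (h : 0 < infOn g D) {x : X} (hx : x ∈ D) :
    infOn g D ≤ g x := by
  refine csInf_le ?_ (mem_image_of_mem g hx)
  by_contra hb
  rw [infOn, Real.sInf_of_not_bddBelow hb] at h
  exact lt_irrefl _ h

theorem CPlus.infOn_le {X : Type*} [TopologicalSpace X] {D : Set X} {g : X → ℝ} (h : CPlus D g)
    {x : X} (hx : x ∈ D) : infOn g D ≤ g x :=
  _root_.infOn_le (zero_lt_one.trans h.2.1) hx

theorem CPlus.le_supOn {X : Type*} [TopologicalSpace X] {D : Set X} {g : X → ℝ} (h : CPlus D g)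
    {x : X} (hx : x ∈ D) : g x ≤ supOn g D :=
  le_csSup h.2.2 (mem_image_of_mem g hx)

/-- Dividing by a function bounded away from zero and infinity preserves and reflects
integrability, so no integrability of `f` is needed here. -/
theorem integral_div_mem_Icc {X : Type*} [MeasurableSpace X] {ν : Measure X} {f g : X → ℝ}
    {lo hi : ℝ} (hlo : 0 < lo) (hg : AEStronglyMeasurable g ν) (hf : ∀ᵐ x ∂ν, 0 ≤ f x)
    (hl : ∀ᵐ x ∂ν, lo ≤ g x) (hh : ∀ᵐ x ∂ν, g x ≤ hi) :
    (∫ x, f x / g x ∂ν) ∈ Set.Icc ((∫ x, f x ∂ν) / hi) ((∫ x, f x ∂ν) / lo) := by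
  by_cases hfi : Integrable f ν
  · have hfg : Integrable (fun x => f x / g x) ν := by
      refine (hfi.bdd_mul (c := lo⁻¹) hg.aemeasurable.inv.aestronglyMeasurable ?_).congr
        (Eventually.of_forall fun x => ?_)
      · filter_upwards [hl] with x hx
        have := hlo.trans_le hx
        rw [Pi.inv_apply, norm_inv, Real.norm_of_nonneg this.le]
        gcongr
      · simp only [Pi.inv_apply]
        ring
    rw [← integral_div, ← integral_div]
    refine ⟨integral_mono_ae (hfi.div_const _) hfg ?_, integral_mono_ae hfg (hfi.div_const _) ?_⟩
    · filter_upwards [hf, hl, hh] with x h0 h1 h2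
      have := hlo.trans_le h1
      gcongr
    · filter_upwards [hf, hl] with x h0 h1
      gcongr
  · have hfg : ¬ Integrable (fun x => f x / g x) ν := fun hfg => hfi <| by
      refine (hfg.bdd_mul (c := hi) hg ?_).congr ?_
      · filter_upwards [hl, hh] with x h1 h2
        rwa [Real.norm_of_nonneg (hlo.le.trans h1)]
      · filter_upwards [hl] with x hx
        have := hlo.trans_le hx
        field_simp
    simp [integral_undef hfi, integral_undef hfg]

theorem X0Norm_nonneg (s : ℝ) (p : Euc N × Euc N → ℝ) (u : Euc N → ℝ) : 0 ≤ X0Norm s p u :=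
  Real.sInf_nonneg fun _ hη => hη.1.le

theorem pairNorm_nonneg (s : ℝ) (p : Euc N × Euc N → ℝ) (u v : Euc N → ℝ) :
    0 ≤ pairNorm s p u v :=
  (X0Norm_nonneg s p u).trans (le_max_left _ _)

theorem MemX0.integrable {Ω : Set (Euc N)} {s : ℝ} {p : Euc N × Euc N → ℝ} {u : Euc N → ℝ}
    (hu : MemX0 Ω s p u) (hp : CPlus univ p) :
    Integrable fun z : Euc N × Euc N =>
      |u z.1 - u z.2| ^ p z / ‖z.1 - z.2‖ ^ ((N : ℝ) + s * p z) := by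
  obtain ⟨-, -, η, hη, hi⟩ := hu
  have hpc : Continuous p := continuousOn_univ.1 hp.1
  refine (hi.bdd_mul (f := fun z => η ^ p z) (c := max 1 η ^ supOn p univ)
    (Continuous.aestronglyMeasurable (by fun_prop (disch := positivity)))
    (Eventually.of_forall fun z => ?_)).congr (Eventually.of_forall fun z => ?_)
  · rw [Real.norm_of_nonneg (by positivity)]
    have h1 : 0 ≤ p z := by linarith [hp.2.1, hp.infOn_le (mem_univ z)]
    calc η ^ p z ≤ max 1 η ^ p z := Real.rpow_le_rpow hη.le (le_max_right _ _) h1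
      _ ≤ _ := Real.rpow_le_rpow_of_exponent_le (le_max_left _ _) (hp.le_supOn (mem_univ z))
  · have : η ^ p z ≠ 0 := (Real.rpow_pos_of_pos hη _).ne'
    simp only
    rw [← mul_div_assoc, mul_div_mul_left _ _ this]

theorem MemX0.rpow_X0Norm_le_rhoX0 {Ω : Set (Euc N)} {s : ℝ} {p : Euc N × Euc N → ℝ}
    {u : Euc N → ℝ} (hu : MemX0 Ω s p u) (hp : CPlus univ p) (h1 : 1 < X0Norm s p u) :
    X0Norm s p u ^ infOn p univ ≤ rhoX0 s p u := by
  have hp0 : 0 < infOn p univ := zero_lt_one.trans hp.2.1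
  have key : ∀ η ∈ Set.Ioo 1 (X0Norm s p u), η ^ infOn p univ ≤ rhoX0 s p u := by
    rintro η ⟨hη1, hη2⟩
    have hη : 0 < η := zero_lt_one.trans hη1
    have hg : 1 < gagliardoOn univ s p u η := by
      by_contra! hc
      exact hη2.not_ge (csInf_le ⟨0, fun _ hx => hx.1.le⟩ ⟨hη, hc⟩)
    have hle : gagliardoOn univ s p u η ≤ rhoX0 s p u / η ^ infOn p univ := by
      rw [gagliardoOn, Measure.restrict_univ, rhoX0, ← integral_div]
      refine integral_mono_of_nonneg (Eventually.of_forall fun z => by positivity)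
        ((hu.integrable hp).div_const _) (Eventually.of_forall fun z => ?_)
      simp only
      rw [mul_comm, ← div_div]
      have := Real.rpow_le_rpow_of_exponent_le hη1.le (hp.infOn_le (mem_univ z))
      gcongr
    have := hg.le.trans hle
    rwa [one_le_div (by positivity)] at this
  have ht : Tendsto (fun η : ℝ => η ^ infOn p univ) (𝓝[<] X0Norm s p u)
      (𝓝 (X0Norm s p u ^ infOn p univ)) :=
    (Real.continuousAt_rpow_const _ _ (Or.inr hp0.le)).tendsto.mono_left nhdsWithin_le_nhds
  exact le_of_tendsto ht (eventually_of_mem (Ioo_mem_nhdsLT h1) key)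

theorem Pfun_nonneg (s : ℝ) (p : Euc N × Euc N → ℝ) (u v : Euc N → ℝ) : 0 ≤ Pfun s p u v :=
  integral_nonneg fun z => by positivity

theorem Pfun_eq_add {Ω : Set (Euc N)} {s : ℝ} {p : Euc N × Euc N → ℝ} {u v : Euc N → ℝ}
    (hu : MemX0 Ω s p u) (hv : MemX0 Ω s p v) (hp : CPlus univ p) :
    Pfun s p u v = rhoX0 s p u + rhoX0 s p v := by
  rw [Pfun, rhoX0, rhoX0, ← integral_add (hu.integrable hp) (hv.integrable hp)]
  simp only [add_div]

theorem rhoX0_nonneg (s : ℝ) (p : Euc N × Euc N → ℝ) (u : Euc N → ℝ) : 0 ≤ rhoX0 s p u :=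
  integral_nonneg fun z => by positivity

theorem rpow_pairNorm_le_Pfun {Ω : Set (Euc N)} {s : ℝ} {p : Euc N × Euc N → ℝ}
    {u v : Euc N → ℝ} (hu : MemX0 Ω s p u) (hv : MemX0 Ω s p v) (hp : CPlus univ p)
    (h1 : 1 < pairNorm s p u v) : pairNorm s p u v ^ infOn p univ ≤ Pfun s p u v := by
  rw [Pfun_eq_add hu hv hp]
  have hu0 := rhoX0_nonneg s p u
  have hv0 := rhoX0_nonneg s p v
  rcases max_choice (X0Norm s p u) (X0Norm s p v) with hm | hm
  · rw [pairNorm, hm] at h1 ⊢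
    linarith [hu.rpow_X0Norm_le_rhoX0 hp h1]
  · rw [pairNorm, hm] at h1 ⊢
    linarith [hv.rpow_X0Norm_le_rhoX0 hp h1]

/-- On the Nehari manifold, `R` can be eliminated from the lower bound for the energy. -/
theorem InNehari.le_Jfun {Ω : Set (Euc N)} {s : ℝ} {p : Euc N × Euc N → ℝ}
    {q α β a b c : Euc N → ℝ} {lam mu : ℝ} {u v : Euc N → ℝ} (hΩ : IsOpen Ω)
    (hp : CPlus univ p) (hq : CPlus (closure Ω) q) (hα : CPlus (closure Ω) α)
    (hβ : CPlus (closure Ω) β) (ha : ∀ x, 0 ≤ a x) (hb : ∀ x, 0 ≤ b x) (hc : ∀ x, 0 ≤ c x)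
    (hlam : 0 ≤ lam) (hmu : 0 ≤ mu) (huv : InNehari Ω s p q α β a b c lam mu u v) :
    (1 / supOn p univ - 1 / (infOn α (closure Ω) + infOn β (closure Ω))) * Pfun s p u v -
        (1 / infOn q (closure Ω) - 1 / (infOn α (closure Ω) + infOn β (closure Ω))) *
          Qfun Ω q a b lam mu u v ≤
      Jfun Ω s p q α β a b c lam mu u v := by
  have hmeas : ∀ {g : Euc N → ℝ}, ContinuousOn g (closure Ω) →
      AEStronglyMeasurable g (volume.restrict Ω) := fun hg =>
    (hg.mono subset_closure).aestronglyMeasurable hΩ.measurableSet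
  have hin : ∀ᵐ x ∂(volume.restrict Ω), x ∈ closure Ω :=
    (ae_restrict_mem hΩ.measurableSet).mono fun x hx => subset_closure hx
  have hP := (integral_div_mem_Icc (ν := volume)
    (f := fun z : Euc N × Euc N => (|u z.1 - u z.2| ^ p z + |v z.1 - v z.2| ^ p z) /
      ‖z.1 - z.2‖ ^ ((N : ℝ) + s * p z)) (zero_lt_one.trans hp.2.1)
    (continuousOn_univ.1 hp.1).aestronglyMeasurable
    (Eventually.of_forall fun z => by positivity)
    (Eventually.of_forall fun z => hp.infOn_le (mem_univ z))
    (Eventually.of_forall fun z => hp.le_supOn (mem_univ z))).1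
  have hQ := (integral_div_mem_Icc
    (f := fun x => lam * a x * |u x| ^ q x + mu * b x * |v x| ^ q x)
    (zero_lt_one.trans hq.2.1) (hmeas hq.1)
    (Eventually.of_forall fun x => by have := ha x; have := hb x; positivity)
    (hin.mono fun x hx => hq.infOn_le hx) (hin.mono fun x hx => hq.le_supOn hx)).2
  have hR := (integral_div_mem_Icc
    (f := fun x => c x * |u x| ^ α x * |v x| ^ β x) (g := fun x => α x + β x)
    (add_pos (zero_lt_one.trans hα.2.1) (zero_lt_one.trans hβ.2.1)) (hmeas (hα.1.add hβ.1))
    (Eventually.of_forall fun x => by have := hc x; positivity)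
    (hin.mono fun x hx => add_le_add (hα.infOn_le hx) (hβ.infOn_le hx))
    (hin.mono fun x hx => add_le_add (hα.le_supOn hx) (hβ.le_supOn hx))).2
  simp only [div_div _ _ (p _),
    fun z => mul_comm (‖z.1 - z.2‖ ^ ((N : ℝ) + s * p z)) (p z)] at hP
  have hN := huv.2.2.2
  rw [← Pfun] at hP
  rw [← Qfun] at hQ
  rw [← Rfun, show Rfun Ω α β c u v = Pfun s p u v - Qfun Ω q a b lam mu u v by linarith] at hR
  rw [Jfun]
  calc _ = Pfun s p u v / supOn p univ - Qfun Ω q a b lam mu u v / infOn q (closure Ω) -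
      (Pfun s p u v - Qfun Ω q a b lam mu u v) /
        (infOn α (closure Ω) + infOn β (closure Ω)) := by ring
    _ ≤ _ := by gcongr

theorem tendsto_mul_rpow_sub_mul_rpow_atTop {k m r t : ℝ} (hk : 0 < k) (ht : 0 < t)
    (hr : t < r) : Tendsto (fun x : ℝ => k * x ^ r - m * x ^ t) atTop atTop := by
  have h1 : Tendsto (fun x : ℝ => k * x ^ (r - t) - m) atTop atTop :=
    tendsto_atTop_add_const_right _ _
      ((tendsto_rpow_atTop (sub_pos.2 hr)).const_mul_atTop hk)
  refine ((tendsto_rpow_atTop ht).atTop_mul_atTop₀ h1).congr' ?_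
  filter_upwards [eventually_gt_atTop 0] with x hx
  have : x ^ r = x ^ t * x ^ (r - t) := by rw [← Real.rpow_add hx]; ring_nf
  rw [this]
  ring

/-- for `λ + μ < δ`, `J_{λ,μ}` is coercive and bounded below on
the Nehari manifold. -/
theorem J_coercive_bounded_below
    (N : ℕ) (Ω : Set (Euc N)) (s : ℝ) (p : Euc N × Euc N → ℝ)
    (q α β a b c : Euc N → ℝ) (h : HypAll N Ω s p q α β a b c)
    (C₁ C₂ : ℝ) (hC₁ : 0 < C₁) (hC₂ : 1 < C₂)
    (hQ : QEstimate Ω s p q a b C₁) (hR : REstimate Ω s p α β c C₂)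
    (lam mu : ℝ) (hlam : 0 < lam) (hmu : 0 < mu)
    (hlm : lam + mu < deltaConst Ω p q α β C₁ C₂) :
    (∃ M : ℝ, ∀ u v : Euc N → ℝ, InNehari Ω s p q α β a b c lam mu u v →
      M ≤ Jfun Ω s p q α β a b c lam mu u v) ∧
    (∀ T : ℝ, ∃ ρ : ℝ, ∀ u v : Euc N → ℝ, InNehari Ω s p q α β a b c lam mu u v →
      ρ < pairNorm s p u v → T ≤ Jfun Ω s p q α β a b c lam mu u v) ∧
    (∀ u v : Euc N → ℝ, InNehari Ω s p q α β a b c lam mu u v →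
      1 < pairNorm s p u v →
      (1 / supOn p univ - 1 / (infOn α (closure Ω) + infOn β (closure Ω))) *
          pairNorm s p u v ^ infOn p univ -
        C₁ * (lam + mu) *
          (1 / infOn q (closure Ω) - 1 / (infOn α (closure Ω) + infOn β (closure Ω))) *
          pairNorm s p u v ^ supOn q (closure Ω) ≤
        Jfun Ω s p q α β a b c lam mu u v) := by
  obtain ⟨-, hΩ, -, hne, -, -, hp, -, -, hq, hα, hβ, hqp, hpab, -, -, -, -, -, ha, hb, hc, -⟩ := h
  have hJ := fun u v huv => InNehari.le_Jfun (s := s) (u := u) (v := v) hΩ hp hq hα hβ ha hb hc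
    hlam.le hmu.le huv
  have hPn := fun u v (huv : InNehari Ω s p q α β a b c lam mu u v) =>
    rpow_pairNorm_le_Pfun huv.1 huv.2.1 hp
  have hQn := fun u v (huv : InNehari Ω s p q α β a b c lam mu u v) =>
    hQ lam mu hlam hmu u v huv.1 huv.2.1
  obtain ⟨x₀, hx₀⟩ := hne
  have hqq := (hq.infOn_le (subset_closure hx₀)).trans (hq.le_supOn (subset_closure hx₀))
  have hpp := (hp.infOn_le (mem_univ (x₀, x₀))).trans (hp.le_supOn (mem_univ (x₀, x₀)))
  have hq1 := hq.2.1
  set ab := infOn α (closure Ω) + infOn β (closure Ω)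
  set qm := infOn q (closure Ω)
  set qp := supOn q (closure Ω)
  set pm := infOn p univ
  set pp := supOn p univ
  have hk : 0 < 1 / pp - 1 / ab :=
    sub_pos.2 (one_div_lt_one_div_of_lt (by linarith) hpab)
  have hm : 0 < 1 / qm - 1 / ab :=
    sub_pos.2 (one_div_lt_one_div_of_lt (by linarith) (by linarith))
  have hC : 0 < C₁ * (lam + mu) := by positivity
  have hmain : ∀ u v : Euc N → ℝ, InNehari Ω s p q α β a b c lam mu u v →
      1 < pairNorm s p u v →
      (1 / pp - 1 / ab) * pairNorm s p u v ^ pm -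
        C₁ * (lam + mu) * (1 / qm - 1 / ab) * pairNorm s p u v ^ qp ≤
        Jfun Ω s p q α β a b c lam mu u v := by
    intro u v huv h1
    have hQ' := hQn u v huv
    rw [max_eq_right (Real.rpow_le_rpow_of_exponent_le h1.le hqq)] at hQ'
    have e1 := mul_le_mul_of_nonneg_left (hPn u v huv h1) hk.le
    have e2 := mul_le_mul_of_nonneg_left hQ' hm.le
    linarith [hJ u v huv]
  have hlim := tendsto_mul_rpow_sub_mul_rpow_atTop (m := C₁ * (lam + mu) * (1 / qm - 1 / ab))
    hk (by linarith : 0 < qp) hqp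
  have hcoer : ∀ T : ℝ, ∃ ρ : ℝ, 1 ≤ ρ ∧ ∀ u v : Euc N → ℝ,
      InNehari Ω s p q α β a b c lam mu u v →
      ρ < pairNorm s p u v → T ≤ Jfun Ω s p q α β a b c lam mu u v := by
    intro T
    obtain ⟨ρ, hρ⟩ := eventually_atTop.1 (hlim.eventually_ge_atTop T)
    refine ⟨max 1 ρ, le_max_left _ _, fun u v huv hlt => ?_⟩
    exact (hρ _ ((le_max_right _ _).trans hlt.le)).trans
      (hmain u v huv ((le_max_left _ _).trans_lt hlt))
  refine ⟨?_, fun T => (hcoer T).imp fun _ h => h.2, hmain⟩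
  obtain ⟨ρ, hρ1, hρ⟩ := hcoer 0
  refine ⟨min 0 (-((1 / qm - 1 / ab) * (C₁ * (lam + mu) * ρ ^ qp))), fun u v huv => ?_⟩
  rcases lt_or_ge ρ (pairNorm s p u v) with hlt | hle
  · exact (min_le_left _ _).trans (hρ u v huv hlt)
  · refine (min_le_right _ _).trans ?_
    have h0 := pairNorm_nonneg s p u v
    have hmax : max (pairNorm s p u v ^ qm) (pairNorm s p u v ^ qp) ≤ ρ ^ qp :=
      max_le ((Real.rpow_le_rpow h0 hle (by linarith)).trans
        (Real.rpow_le_rpow_of_exponent_le hρ1 hqq)) (Real.rpow_le_rpow h0 hle (by linarith))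
    have e1 := mul_nonneg hk.le (Pfun_nonneg s p u v)
    have e2 := mul_le_mul_of_nonneg_left
      ((hQn u v huv).trans (mul_le_mul_of_nonneg_left hmax hC.le)) hm.le
    linarith [hJ u v huv]
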